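/- Assume T > R > P > S, 2R > T + S, 0 ≤ γ < 1 and γ > (T−R)/(T−P). Let τ be the Grim trigger strategy viewed as a memory-two strategy: τ(s1,s2) = C if s1 = (C,C) and τ(s1,s2) = D otherwise (this strategy is invariant under swapping the two players, so its mirror coincides with τ). Then there exists Q : {C,D} × Ω × Ω → ℝ satisfying the player-1 memory-two Bellman optimality equation against τ such that for all states s1, s2: if s1 = (C,C) then Q(C,s1,s2) > Q(D,s1,s2), and if s1 ≠ (C,C) then Q(D,s1,s2) > Q(C,s1,s2); that is, a pair of Grim trigger strategies forms a symmetric mutual reinforcement learning equilibrium under memory-two reinforcement learning. -/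

import Mathlib

inductive Act where
  | C : Act
  | D : Act
deriving DecidableEq

open Act

abbrev St : Type := Act × Act

/-- Player 1's payoff in the prisoner's dilemma. -/
def r1 (R S T P : ℝ) : Act → Act → ℝ
  | C, C => R
  | C, D => S
  | D, C => T
  | D, D => P

/-- Swap the roles of the two players in a state. -/
def pi' (s : St) : St := (s.2, s.1)

/-- the Grim trigger strategy, viewed as a memory-two strategy, forms a symmetric
mutual reinforcement learning equilibrium under memory-two reinforcement learning when
`γ > (T−R)/(T−P)`. -/
theorem stmt_17 (R S T P γ : ℝ) (hTR : T > R) (hRP : R > P) (hPS : P > S)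
    (h2R : 2 * R > T + S) (hγ0 : 0 ≤ γ) (hγ1 : γ < 1)
    (hγc : γ > (T - R) / (T - P))
    (τ : St → St → Act) (hτ : ∀ s1 s2, τ s1 s2 = if s1 = (C, C) then C else D) :
    ∃ Q : Act → St → St → ℝ,
      (∀ σ s1 s2, Q σ s1 s2 =
        r1 R S T P σ (τ s1 s2) +
          γ * max (Q C (σ, τ s1 s2) s1) (Q D (σ, τ s1 s2) s1)) ∧
      (∀ s1 s2 : St, (s1 = (C, C) → Q C s1 s2 > Q D s1 s2) ∧
        (s1 ≠ (C, C) → Q D s1 s2 > Q C s1 s2)) := by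
  obtain rfl : τ = fun s1 _ => if s1 = (C, C) then C else D :=
    funext fun s1 => funext fun s2 => hτ s1 s2
  have hγ : 0 < 1 - γ := by linarith
  obtain ⟨v, hv⟩ : ∃ v : ℝ, v = R + γ * v := ⟨R / (1 - γ), by field_simp; ring⟩
  obtain ⟨w, hw⟩ : ∃ w : ℝ, w = P + γ * w := ⟨P / (1 - γ), by field_simp; ring⟩
  have hγ' : T - R < γ * (T - P) := (div_lt_iff₀ (by linarith)).1 hγc
  have hdev : T + γ * w < v := by
    have h : 0 < (1 - γ) * (v - (T + γ * w)) := by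
      linear_combination hγ' - hv + γ * hw
    linarith [pos_of_mul_pos_right h hγ.le]
  have hcoop : max v (T + γ * w) = v := max_eq_left hdev.le
  have hpun : max (S + γ * w) w = w := max_eq_right (by linarith)
  refine ⟨fun σ s1 _ => if s1 = (C, C) then (if σ = C then v else T + γ * w)
    else (if σ = C then S + γ * w else w), ?_, ?_⟩
  · rintro σ s1 -
    by_cases h : s1 = (C, C) <;> cases σ <;> simp [h, r1, hcoop, hpun] <;> assumption
  · intro s1 s2
    refine ⟨fun h => ?_, fun h => ?_⟩ <;> simp only [h, if_true, if_false, reduceCtorEq]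
    · exact hdev
    · linarith
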